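/- Let V_s and V_t be nonempty finite sets (source and target node sets), Z and Y types, B ≥ 0, and L : Y → Y → ℝ a loss function satisfying 0 ≤ L(a,b) ≤ B and the triangle inequality L(a,c) ≤ L(a,b) + L(b,c) for all a,b,c ∈ Y. Let H be a nonempty set of hypotheses Z → Y. For each depth m ∈ ℕ let F_m^s : V_s → Z and F_m^t : V_t → Z be subtree representation maps, and let d(m) be the depth-m base discrepancy d(m) = sup_{h,h' ∈ H} | (1/|V_s|) ∑_{v ∈ V_s} L(h(F_m^s v), h'(F_m^s v)) − (1/|V_t|) ∑_{v ∈ V_t} L(h(F_m^t v), h'(F_m^t v)) |. Assume the sequence d is monotone nondecreasing and that the Cesàro means M ↦ (1/(M+1)) ∑_{m=0}^{M} d(m) converge to a real number S (the Graph Subtree Discrepancy). Fix a final depth ℓ ∈ ℕ and write f_s = F_ℓ^s, f_t = F_ℓ^t, and let y_s : V_s → Y and y_t : V_t → Y be labeling functions. Then for all h, h_s, h_t ∈ H, (1/|V_t|) ∑_{v ∈ V_t} L(h(f_t v), y_t v) ≤ (1/|V_s|) ∑_{v ∈ V_s} L(h(f_s v), y_s v) + S + (1/|V_t|) ∑_{v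 ∈ V_t} L(h_s(f_t v), h_t(f_t v)) + (1/|V_s|) ∑_{v ∈ V_s} L(y_s v, h_s(f_s v)) + (1/|V_t|) ∑_{v ∈ V_t} L(h_t(f_t v), y_t v). -/

import Mathlib

open Finset

/-- A term of a monotone real sequence is at most the limit of the Cesàro means. -/
theorem Monotone.le_of_tendsto_cesaro {d : ℕ → ℝ} (hd : Monotone d) {S : ℝ}
    (hS : Filter.Tendsto (fun M : ℕ => (∑ m ∈ Finset.range (M + 1), d m) / (M + 1))
      Filter.atTop (nhds S)) (n : ℕ) : d n ≤ S := by
  have hmin : Filter.Tendsto (fun m => min (d m) (d n)) Filter.atTop (nhds (d n)) := by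
    refine tendsto_const_nhds.congr' ?_
    filter_upwards [Filter.eventually_ge_atTop n] with m hm
    exact (min_eq_right (hd hm)).symm
  refine le_of_tendsto_of_tendsto'
    (hmin.cesaro.comp (Filter.tendsto_add_atTop_nat 1)) hS fun M => ?_
  rw [Function.comp_apply, div_eq_inv_mul, Nat.cast_add_one]
  gcongr
  exact min_le_left _ _

/-- The average of a finite family with values in `[0, B]` lies in `[0, B]`. -/
theorem sum_div_card_mem_Icc {V : Type*} [Fintype V] [Nonempty V] {f : V → ℝ} {B : ℝ}
    (hf : ∀ v, f v ∈ Set.Icc 0 B) : (∑ v, f v) / Fintype.card V ∈ Set.Icc 0 B := by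
  refine ⟨div_nonneg (Finset.sum_nonneg fun v _ => (hf v).1) (Nat.cast_nonneg _), ?_⟩
  rw [div_le_iff₀ (Nat.cast_pos.2 Fintype.card_pos), mul_comm, ← nsmul_eq_mul]
  exact Finset.sum_le_card_nsmul _ _ _ fun v _ => (hf v).2

/-- Averages inherit a pointwise triangle inequality. -/
theorem sum_div_card_triangle {V Y : Type*} [Fintype V] {L : Y → Y → ℝ}
    (hL : ∀ a b c, L a c ≤ L a b + L b c) (a b c : V → Y) :
    (∑ v, L (a v) (c v)) / Fintype.card V ≤
      (∑ v, L (a v) (b v)) / Fintype.card V + (∑ v, L (b v) (c v)) / Fintype.card V := by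
  rw [← add_div, ← Finset.sum_add_distrib]
  gcongr
  exact hL _ _ _

/-- Theorem 1 (cross-network node classification bound): the target node
classification error is bounded by the source error, the Graph Subtree
Discrepancy `S` (the limit of the Cesàro means of the per-depth base
discrepancies `d`), the target disagreement of the reference hypotheses
`hs, ht`, and their respective source/target errors. -/
theorem cross_network_node_classification_bound
    (Vs Vt : Type*) [Fintype Vs] [Fintype Vt] [Nonempty Vs] [Nonempty Vt]
    (Z Y : Type*) (B : ℝ) (hB : 0 ≤ B)
    (L : Y → Y → ℝ)
    (hL0 : ∀ a b, 0 ≤ L a b) (hLB : ∀ a b, L a b ≤ B)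
    (hLtri : ∀ a b c, L a c ≤ L a b + L b c)
    (H : Set (Z → Y)) (hH : H.Nonempty)
    (Fs : ℕ → Vs → Z) (Ft : ℕ → Vt → Z)
    (d : ℕ → ℝ)
    (hd : ∀ m, d m = sSup {x : ℝ | ∃ h ∈ H, ∃ h' ∈ H,
      x = |(∑ v : Vs, L (h (Fs m v)) (h' (Fs m v))) / (Fintype.card Vs)
          - (∑ v : Vt, L (h (Ft m v)) (h' (Ft m v))) / (Fintype.card Vt)|})
    (hmono : Monotone d)
    (S : ℝ)
    (hS : Filter.Tendsto
      (fun M : ℕ => (∑ m ∈ Finset.range (M + 1), d m) / (M + 1))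
      Filter.atTop (nhds S))
    (ℓ : ℕ) (fs : Vs → Z) (ft : Vt → Z)
    (hfs : fs = Fs ℓ) (hft : ft = Ft ℓ)
    (ys : Vs → Y) (yt : Vt → Y) :
    ∀ h ∈ H, ∀ hs ∈ H, ∀ ht ∈ H,
      (∑ v : Vt, L (h (ft v)) (yt v)) / (Fintype.card Vt) ≤
        (∑ v : Vs, L (h (fs v)) (ys v)) / (Fintype.card Vs)
        + S
        + (∑ v : Vt, L (hs (ft v)) (ht (ft v))) / (Fintype.card Vt)
        + (∑ v : Vs, L (ys v) (hs (fs v))) / (Fintype.card Vs)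
        + (∑ v : Vt, L (ht (ft v)) (yt v)) / (Fintype.card Vt) := by
  subst hfs hft
  intro h hh hs hhs ht _
  have hbdd : BddAbove {x : ℝ | ∃ h ∈ H, ∃ h' ∈ H,
      x = |(∑ v : Vs, L (h (Fs ℓ v)) (h' (Fs ℓ v))) / (Fintype.card Vs)
          - (∑ v : Vt, L (h (Ft ℓ v)) (h' (Ft ℓ v))) / (Fintype.card Vt)|} := by
    refine ⟨B, ?_⟩
    rintro _ ⟨g, -, g', -, rfl⟩
    have hbound : ∀ z, L (g z) (g' z) ∈ Set.Icc 0 B := fun z => ⟨hL0 _ _, hLB _ _⟩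
    obtain ⟨hs0, hsB⟩ := sum_div_card_mem_Icc fun v => hbound (Fs ℓ v)
    obtain ⟨ht0, htB⟩ := sum_div_card_mem_Icc fun v => hbound (Ft ℓ v)
    exact abs_sub_le_of_nonneg_of_le hs0 hsB ht0 htB
  have hdisc := le_csSup hbdd ⟨h, hh, hs, hhs, rfl⟩
  rw [← hd ℓ] at hdisc
  have hdS := hmono.le_of_tendsto_cesaro hS ℓ
  have htransfer := (abs_le.1 hdisc).1
  have hsource := sum_div_card_triangle hLtri (fun v => h (Fs ℓ v)) ys (fun v => hs (Fs ℓ v))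
  have htarget := sum_div_card_triangle hLtri (fun v => h (Ft ℓ v)) (fun v => hs (Ft ℓ v)) yt
  have hreference := sum_div_card_triangle hLtri (fun v => hs (Ft ℓ v)) (fun v => ht (Ft ℓ v)) yt
  linarith
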